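/- In the interval decomposition associated with an ∞-cyclically monotone optimal plan γ̄ (intervals (a_i,b_i) of (a,b)\M_γ̄ with images (c_i,d_i)), for any optimal plan γ and each index i, the restriction γ⌊([a_i,b_i] × ℝ) is concentrated on [a_i,b_i] × [c_i,d_i], and its marginals are μ_i := μ⌊[a_i,b_i] and ν_i := ν⌊[c_i,d_i]; in particular μ_i and ν_i have the same total mass. -/

import Mathlib

open MeasureTheory Set Filter Topology
open scoped ENNReal NNReal

noncomputable section

/-- Topological support of a measure: points all of whose open neighborhoods have
positive measure. -/
def mSupport {α : Type*} [TopologicalSpace α] [MeasurableSpace α] (γ : Measure α) : Set α :=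
  {x | ∀ U : Set α, IsOpen U → x ∈ U → 0 < γ U}

/-- γ is a transport plan (coupling) between μ and ν. -/
def IsCoupling {α : Type*} [MeasurableSpace α] (μ ν : Measure α) (γ : Measure (α × α)) : Prop :=
  γ.fst = μ ∧ γ.snd = ν

/-- The γ-essential supremum of the distance |x - y|. -/
def costInf {α : Type*} [MeasurableSpace α] [PseudoEMetricSpace α]
    (γ : Measure (α × α)) : ℝ≥0∞ :=
  essSup (fun p => edist p.1 p.2) γ

/-- The L^∞ optimal transport cost W∞(μ, ν). -/
def Winfty {α : Type*} [MeasurableSpace α] [PseudoEMetricSpace α] (μ ν : Measure α) : ℝ≥0∞ :=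
  ⨅ (γ : Measure (α × α)) (_ : IsCoupling μ ν γ), costInf γ

/-- γ is an optimal plan for the L^∞ optimal transport problem. -/
def IsOptimalPlan {α : Type*} [MeasurableSpace α] [PseudoEMetricSpace α]
    (μ ν : Measure α) (γ : Measure (α × α)) : Prop :=
  IsCoupling μ ν γ ∧ costInf γ = Winfty μ ν

/-- μ is compactly supported. -/
def CompactlySupported {α : Type*} [TopologicalSpace α] [MeasurableSpace α]
    (μ : Measure α) : Prop :=
  ∃ K : Set α, IsCompact K ∧ μ Kᶜ = 0

/-- The admissible class U_λ of the dual problem. -/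
def DualAdm {α : Type*} [MeasurableSpace α] [PseudoMetricSpace α]
    (μ ν : Measure α) (lam : ℝ) (φ ψ : α → ℝ) : Prop :=
  Integrable φ μ ∧ Integrable ψ ν ∧
    ∀ᵐ x ∂μ, ∀ᵐ y ∂ν, dist x y ≤ lam → φ x + ψ y ≤ 0

/-- ∞-cyclical monotonicity of a plan on ℝ. -/
def InfCM (γ : Measure (ℝ × ℝ)) : Prop :=
  ∀ (n : ℕ) (p : Fin (n + 1) → ℝ × ℝ), (∀ i, p i ∈ mSupport γ) →
    (⨆ i, |(p i).1 - (p i).2|) ≤ ⨆ i, |(p i).1 - (p (i + 1)).2|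

/-- Points moved at maximal distance to the right. -/
def Mplus (γ : Measure (ℝ × ℝ)) (lam : ℝ) : Set ℝ := {x | (x, x + lam) ∈ mSupport γ}

/-- Points moved at maximal distance to the left. -/
def Mminus (γ : Measure (ℝ × ℝ)) (lam : ℝ) : Set ℝ := {x | (x, x - lam) ∈ mSupport γ}


/-- (ai, bi) is a maximal open subinterval (a "gap") of (a, b) \ M. -/
def IsGap (a b : ℝ) (M : Set ℝ) (ai bi : ℝ) : Prop :=
  ai < bi ∧ Set.Ioo ai bi ⊆ Set.Ioo a b \ M ∧
    ∀ a' b' : ℝ, a' < b' → Set.Ioo a' b' ⊆ Set.Ioo a b \ M →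
      Set.Ioo ai bi ⊆ Set.Ioo a' b' → a' = ai ∧ b' = bi

open scoped Classical in
/-- The left image c_i associated with a gap endpoint a_i: c if a_i = a,
a_i + λ_C if a_i ∈ M⁺, and a_i − λ_C otherwise (i.e. if a_i ∈ M⁻ \ M⁺). -/
noncomputable def cIdx (a c lam : ℝ) (Mp : Set ℝ) (ai : ℝ) : ℝ :=
  if ai = a then c else if ai ∈ Mp then ai + lam else ai - lam

open scoped Classical in
/-- The right image d_i associated with a gap endpoint b_i: d if b_i = b,
b_i − λ_C if b_i ∈ M⁻, and b_i + λ_C otherwise (i.e. if b_i ∈ M⁺ \ M⁻). -/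
noncomputable def dIdx (b d lam : ℝ) (Mm : Set ℝ) (bi : ℝ) : ℝ :=
  if bi = b then d else if bi ∈ Mm then bi - lam else bi + lam

lemma mSupport_eq_support {α : Type*} [TopologicalSpace α] [MeasurableSpace α] (γ : Measure α) :
    mSupport γ = γ.support := by
  ext x
  rw [Measure.mem_support_iff_forall]
  refine ⟨fun h U hU => ?_, fun h U hU hx => h U (hU.mem_nhds hx)⟩
  obtain ⟨V, hVU, hV, hx⟩ := mem_nhds_iff.1 hU
  exact (h V hV hx).trans_le (measure_mono hVU)

lemma ae_mem_mSupport {α : Type*} [TopologicalSpace α] [SecondCountableTopology α]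
    [MeasurableSpace α] (γ : Measure α) : ∀ᵐ x ∂γ, x ∈ mSupport γ := by
  rw [mSupport_eq_support]
  exact Measure.support_mem_ae

lemma isClosed_mSupport {α : Type*} [TopologicalSpace α] [MeasurableSpace α] (γ : Measure α) :
    IsClosed (mSupport γ) := by
  rw [mSupport_eq_support]
  exact Measure.isClosed_support

lemma isClosed_Mplus (γ : Measure (ℝ × ℝ)) (lam : ℝ) : IsClosed (Mplus γ lam) :=
  (isClosed_mSupport γ).preimage (by fun_prop : Continuous fun x : ℝ => (x, x + lam))

lemma isClosed_Mminus (γ : Measure (ℝ × ℝ)) (lam : ℝ) : IsClosed (Mminus γ lam) :=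
  (isClosed_mSupport γ).preimage (by fun_prop : Continuous fun x : ℝ => (x, x - lam))

namespace IsCoupling

variable {μ ν : Measure ℝ} {γ : Measure (ℝ × ℝ)}

lemma ae_fst (h : IsCoupling μ ν γ) {P : ℝ → Prop} (hP : ∀ᵐ x ∂μ, P x) : ∀ᵐ p ∂γ, P p.1 := by
  rw [← h.1] at hP
  exact ae_of_ae_map measurable_fst.aemeasurable hP

lemma ae_snd (h : IsCoupling μ ν γ) {P : ℝ → Prop} (hP : ∀ᵐ x ∂ν, P x) : ∀ᵐ p ∂γ, P p.2 := by
  rw [← h.2] at hP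
  exact ae_of_ae_map measurable_snd.aemeasurable hP

lemma measure_fst (h : IsCoupling μ ν γ) {s : Set ℝ} (hs : MeasurableSet s) :
    γ (Prod.fst ⁻¹' s) = μ s := by
  rw [← h.1, Measure.fst_apply hs]

lemma measure_snd (h : IsCoupling μ ν γ) {s : Set ℝ} (hs : MeasurableSet s) :
    γ (Prod.snd ⁻¹' s) = ν s := by
  rw [← h.2, Measure.snd_apply hs]

/-- If, up to null sets, either of `{x ≤ s}` and `{y ≤ t}` contains the other, then equality of the
measures of these half-lines makes the two events agree almost everywhere. -/
lemma ae_le_iff_le [IsFiniteMeasure μ] [IsFiniteMeasure ν] (h : IsCoupling μ ν γ) {s t : ℝ}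
    (hst : μ (Iic s) = ν (Iic t))
    (hle : (∀ᵐ p ∂γ, p.1 ≤ s → p.2 ≤ t) ∨ ∀ᵐ p ∂γ, p.2 ≤ t → p.1 ≤ s) :
    ∀ᵐ p ∂γ, p.1 ≤ s ↔ p.2 ≤ t := by
  have h1 := h.measure_fst (measurableSet_Iic (a := s))
  have h2 := h.measure_snd (measurableSet_Iic (a := t))
  have m1 : MeasurableSet (Prod.fst ⁻¹' Iic s : Set (ℝ × ℝ)) := measurable_fst measurableSet_Iic
  have m2 : MeasurableSet (Prod.snd ⁻¹' Iic t : Set (ℝ × ℝ)) := measurable_snd measurableSet_Iic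
  rcases hle with hle | hle
  · have := ae_eq_of_ae_subset_of_measure_ge (μ := γ) (s := Prod.fst ⁻¹' Iic s)
      (t := Prod.snd ⁻¹' Iic t) hle (by rw [h1, h2, hst]) m1.nullMeasurableSet
      (by rw [h2]; exact measure_ne_top _ _)
    exact eventuallyEq_set.1 this
  · have := ae_eq_of_ae_subset_of_measure_ge (μ := γ) (s := Prod.snd ⁻¹' Iic t)
      (t := Prod.fst ⁻¹' Iic s) hle (by rw [h1, h2, hst]) m2.nullMeasurableSet
      (by rw [h1]; exact measure_ne_top _ _)
    exact eventuallyEq_set.1 this.symm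

lemma measure_Iic_eq [NullSingletonClass μ] [NullSingletonClass ν] (h : IsCoupling μ ν γ) {s t : ℝ}
    (hst : ∀ᵐ p ∂γ, p.1 < s → p.2 ≤ t) (hts : ∀ᵐ p ∂γ, p.2 < t → p.1 ≤ s) :
    μ (Iic s) = ν (Iic t) := by
  apply le_antisymm
  · rw [← measure_congr (Iio_ae_eq_Iic (μ := μ)), ← h.measure_fst measurableSet_Iio,
      ← h.measure_snd measurableSet_Iic]
    exact measure_mono_ae hst
  · rw [← measure_congr (Iio_ae_eq_Iic (μ := ν)), ← h.measure_snd measurableSet_Iio,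
      ← h.measure_fst measurableSet_Iic]
    exact measure_mono_ae hts

end IsCoupling

lemma InfCM.abs_le_max {γ : Measure (ℝ × ℝ)} (hcm : InfCM γ) {p q : ℝ × ℝ}
    (hp : p ∈ mSupport γ) (hq : q ∈ mSupport γ) :
    |p.1 - p.2| ≤ max |p.1 - q.2| |q.1 - p.2| := by
  have h := hcm 1 ![p, q] (by intro i; fin_cases i <;> assumption)
  refine (le_trans ?_ h).trans (ciSup_le fun i => ?_)
  · exact le_ciSup (f := fun i : Fin 2 => |(![p, q] i).1 - (![p, q] i).2|)
      (finite_range _).bddAbove 0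
  · fin_cases i
    · exact le_max_left _ _
    · exact le_max_right _ _

section Tight

variable {μ ν : Measure ℝ} {γ : Measure (ℝ × ℝ)} {lam : ℝ}
  [NullSingletonClass μ] [NullSingletonClass ν]

lemma measure_Iic_eq_of_mem_Mplus (hγ : IsCoupling μ ν γ) (hcm : InfCM γ)
    (hlam : ∀ᵐ p ∂γ, |p.1 - p.2| ≤ lam) {x : ℝ} (hx : x ∈ Mplus γ lam) :
    μ (Iic x) = ν (Iic (x + lam)) := by
  refine hγ.measure_Iic_eq ?_ ?_
  · filter_upwards [hlam] with p hp hpx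
    rw [abs_le] at hp
    linarith
  · filter_upwards [hlam, ae_mem_mSupport γ] with p hp hps hpx
    by_contra! hlt
    have h := hcm.abs_le_max hx hps
    rw [abs_le] at hp
    have h1 : |x - p.2| < lam := abs_lt.2 ⟨by linarith, by linarith⟩
    have h2 : |p.1 - (x + lam)| < lam := abs_lt.2 ⟨by linarith, by linarith⟩
    have h3 : lam ≤ |x - (x + lam)| := by
      rw [abs_sub_comm, add_sub_cancel_left]
      exact le_abs_self _
    exact absurd (h3.trans h) (max_lt h1 h2).not_ge

lemma measure_Iic_eq_of_mem_Mminus (hγ : IsCoupling μ ν γ) (hcm : InfCM γ)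
    (hlam : ∀ᵐ p ∂γ, |p.1 - p.2| ≤ lam) {x : ℝ} (hx : x ∈ Mminus γ lam) :
    μ (Iic x) = ν (Iic (x - lam)) := by
  refine hγ.measure_Iic_eq ?_ ?_
  · filter_upwards [hlam, ae_mem_mSupport γ] with p hp hps hpx
    by_contra! hlt
    have h := hcm.abs_le_max hx hps
    rw [abs_le] at hp
    have h1 : |x - p.2| < lam := abs_lt.2 ⟨by linarith, by linarith⟩
    have h2 : |p.1 - (x - lam)| < lam := abs_lt.2 ⟨by linarith, by linarith⟩
    have h3 : lam ≤ |x - (x - lam)| := by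
      rw [sub_sub_cancel]
      exact le_abs_self _
    exact absurd (h3.trans h) (max_lt h1 h2).not_ge
  · filter_upwards [hlam] with p hp hpx
    rw [abs_le] at hp
    linarith

end Tight

lemma IsOptimalPlan.ae_abs_sub_le {μ ν : Measure ℝ} {γ : Measure (ℝ × ℝ)}
    (hμ : CompactlySupported μ) (hν : CompactlySupported ν) (hγ : IsOptimalPlan μ ν γ) :
    ∀ᵐ p ∂γ, |p.1 - p.2| ≤ (Winfty μ ν).toReal := by
  obtain ⟨K, hK, hK0⟩ := hμ
  obtain ⟨L, hL, hL0⟩ := hν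
  have hfin : Winfty μ ν ≠ ∞ := by
    have hbd : Bornology.IsBounded (K ∪ L) := (hK.union hL).isBounded
    rw [← hγ.2]
    refine ne_top_of_le_ne_top hbd.ediam_ne_top (essSup_le_of_ae_le _ ?_)
    filter_upwards [hγ.1.ae_fst (P := (· ∈ K)) hK0, hγ.1.ae_snd (P := (· ∈ L)) hL0] with p h1 h2
    exact Metric.edist_le_ediam_of_mem (Or.inl h1) (Or.inr h2)
  filter_upwards [ENNReal.ae_le_essSup (μ := γ) fun p : ℝ × ℝ => edist p.1 p.2] with p hp
  have hp' : edist p.1 p.2 ≤ Winfty μ ν := hγ.2 ▸ hp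
  rw [← Real.dist_eq, dist_edist]
  exact ENNReal.toReal_mono hfin hp'

lemma ae_ne {μ : Measure ℝ} [NullSingletonClass μ] (x : ℝ) : ∀ᵐ y ∂μ, y ≠ x :=
  compl_mem_ae_iff.2 (measure_singleton x)

namespace IsGap

variable {a b ai bi : ℝ} {M : Set ℝ}

lemma left_le (h : IsGap a b M ai bi) : a ≤ ai :=
  ((Ioo_subset_Ioo_iff h.1).1 (h.2.1.trans sdiff_subset)).1

lemma le_right (h : IsGap a b M ai bi) : bi ≤ b :=
  ((Ioo_subset_Ioo_iff h.1).1 (h.2.1.trans sdiff_subset)).2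

lemma left_mem (h : IsGap a b M ai bi) (hM : IsClosed M) (hne : ai ≠ a) : ai ∈ M := by
  by_contra hai
  have hlt : a < ai := lt_of_le_of_ne h.left_le hne.symm
  obtain ⟨e, ⟨hae, hea⟩, he⟩ :=
    (mem_nhdsLE_iff_exists_mem_Ico_Ioc_subset hlt).1
      (mem_nhdsWithin_of_mem_nhds (hM.isOpen_compl.mem_nhds hai))
  refine hea.ne (h.2.2 e bi (hea.trans h.1) (fun x hx => ?_) (Ioo_subset_Ioo_left hea.le)).1
  rcases le_or_gt x ai with hxa | hxa
  · exact ⟨⟨hae.trans_lt hx.1, hx.2.trans_le h.le_right⟩, he ⟨hx.1, hxa⟩⟩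
  · exact h.2.1 ⟨hxa, hx.2⟩

lemma right_mem (h : IsGap a b M ai bi) (hM : IsClosed M) (hne : bi ≠ b) : bi ∈ M := by
  by_contra hbi
  have hlt : bi < b := lt_of_le_of_ne h.le_right hne
  obtain ⟨e, ⟨hbe, heb⟩, he⟩ :=
    (mem_nhdsGE_iff_exists_mem_Ioc_Ico_subset hlt).1
      (mem_nhdsWithin_of_mem_nhds (hM.isOpen_compl.mem_nhds hbi))
  refine hbe.ne' (h.2.2 ai e (h.1.trans hbe) (fun x hx => ?_) (Ioo_subset_Ioo_right hbe.le)).2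
  rcases lt_or_ge x bi with hxb | hxb
  · exact h.2.1 ⟨hx.1, hxb⟩
  · exact ⟨⟨h.left_le.trans_lt hx.1, hx.2.trans_le heb⟩, he ⟨hxb, hx.2⟩⟩

end IsGap

/-- For any optimal plan γ and any gap (a_i, b_i) of (a,b) \ M_γ̄, the restriction of γ
to [a_i,b_i] × ℝ is concentrated on [a_i,b_i] × [c_i,d_i] and has marginals
μ⌊[a_i,b_i] and ν⌊[c_i,d_i]; in particular these have the same total mass. -/
theorem restriction_to_gap
    (μ ν : Measure ℝ)
    [IsProbabilityMeasure μ] [IsProbabilityMeasure ν] [NullSingletonClass μ] [NullSingletonClass ν]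
    (hμ : CompactlySupported μ) (hν : CompactlySupported ν)
    (γbar : Measure (ℝ × ℝ)) (hγbar : IsOptimalPlan μ ν γbar) (hcm : InfCM γbar)
    (lamC : ℝ) (hlamC : lamC = (Winfty μ ν).toReal)
    (a b c d : ℝ)
    (ha : IsGLB (mSupport μ) a) (hb : IsLUB (mSupport μ) b) (hab : a < b)
    (hc : IsGLB (mSupport ν) c) (hd : IsLUB (mSupport ν) d) (hcd : c < d)
    (γ : Measure (ℝ × ℝ)) (hγ : IsOptimalPlan μ ν γ) :
    ∀ ai bi : ℝ, IsGap a b (Mplus γbar lamC ∪ Mminus γbar lamC) ai bi →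
      γ (Set.Icc ai bi ×ˢ
          (Set.Icc (cIdx a c lamC (Mplus γbar lamC) ai)
                   (dIdx b d lamC (Mminus γbar lamC) bi))ᶜ) = 0 ∧
      (γ.restrict (Set.Icc ai bi ×ˢ Set.univ)).fst = μ.restrict (Set.Icc ai bi) ∧
      (γ.restrict (Set.Icc ai bi ×ˢ Set.univ)).snd
        = ν.restrict (Set.Icc (cIdx a c lamC (Mplus γbar lamC) ai)
                              (dIdx b d lamC (Mminus γbar lamC) bi)) ∧
      μ (Set.Icc ai bi)
        = ν (Set.Icc (cIdx a c lamC (Mplus γbar lamC) ai)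
                     (dIdx b d lamC (Mminus γbar lamC) bi)) := by
  subst hlamC
  intro ai bi hgap
  set lamC := (Winfty μ ν).toReal
  have hbar := hγbar.ae_abs_sub_le hμ hν
  have hopt := hγ.ae_abs_sub_le hμ hν
  have hMc := (isClosed_Mplus γbar lamC).union (isClosed_Mminus γbar lamC)
  have hplus : ∀ x ∈ Mplus γbar lamC, ∀ᵐ p ∂γ, p.1 ≤ x ↔ p.2 ≤ x + lamC := fun x hx =>
    hγ.1.ae_le_iff_le (measure_Iic_eq_of_mem_Mplus hγbar.1 hcm hbar hx) <| .inl <| by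
      filter_upwards [hopt] with p hp hpx
      rw [abs_le] at hp
      linarith
  have hminus : ∀ x ∈ Mminus γbar lamC, ∀ᵐ p ∂γ, p.1 ≤ x ↔ p.2 ≤ x - lamC := fun x hx =>
    hγ.1.ae_le_iff_le (measure_Iic_eq_of_mem_Mminus hγbar.1 hcm hbar hx) <| .inr <| by
      filter_upwards [hopt] with p hp hpx
      rw [abs_le] at hp
      linarith
  have hleft : ∀ᵐ p ∂γ, p.1 ≤ ai ↔ p.2 ≤ cIdx a c lamC (Mplus γbar lamC) ai := by
    unfold cIdx
    split_ifs with h1 h2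
    · filter_upwards [hγ.1.ae_fst (ae_mem_mSupport μ), hγ.1.ae_snd (ae_mem_mSupport ν),
        hγ.1.ae_fst (ae_ne a), hγ.1.ae_snd (ae_ne c)] with p hp1 hp2 hpa hpc
      rw [h1]
      exact iff_of_false (((ha.1 hp1).lt_of_ne' hpa).not_ge) (((hc.1 hp2).lt_of_ne' hpc).not_ge)
    · exact hplus ai h2
    · exact hminus ai ((hgap.left_mem hMc h1).resolve_left h2)
  have hright : ∀ᵐ p ∂γ, p.1 ≤ bi ↔ p.2 ≤ dIdx b d lamC (Mminus γbar lamC) bi := by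
    unfold dIdx
    split_ifs with h1 h2
    · filter_upwards [hγ.1.ae_fst (ae_mem_mSupport μ), hγ.1.ae_snd (ae_mem_mSupport ν)]
        with p hp1 hp2
      rw [h1]
      exact iff_of_true (hb.1 hp1) (hd.1 hp2)
    · exact hminus bi h2
    · exact hplus bi ((hgap.right_mem hMc h1).resolve_right h2)
  set ci := cIdx a c lamC (Mplus γbar lamC) ai
  set di := dIdx b d lamC (Mminus γbar lamC) bi
  have hiff : ∀ᵐ p ∂γ, p.1 ∈ Icc ai bi ↔ p.2 ∈ Icc ci di := by
    filter_upwards [hleft, hright, hγ.1.ae_fst (ae_ne ai), hγ.1.ae_snd (ae_ne ci)]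
      with p hl hr hpa hpc
    have h1 : ai ≤ p.1 ↔ ¬ p.1 ≤ ai := by
      rw [not_le]; exact ⟨fun h => h.lt_of_ne' hpa, le_of_lt⟩
    have h2 : ci ≤ p.2 ↔ ¬ p.2 ≤ ci := by
      rw [not_le]; exact ⟨fun h => h.lt_of_ne' hpc, le_of_lt⟩
    rw [mem_Icc, mem_Icc, h1, h2, hl, hr]
  have hset : (Prod.fst ⁻¹' Icc ai bi : Set (ℝ × ℝ)) =ᵐ[γ] Prod.snd ⁻¹' Icc ci di :=
    eventuallyEq_set.2 hiff
  refine ⟨?_, ?_, ?_, ?_⟩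
  · refine measure_mono_null (t := {p | ¬ (p.1 ∈ Icc ai bi ↔ p.2 ∈ Icc ci di)}) ?_ hiff
    exact fun p hp h => hp.2 (h.1 hp.1)
  · rw [prod_univ, Measure.fst, ← Measure.restrict_map measurable_fst measurableSet_Icc]
    exact congrArg (Measure.restrict · _) hγ.1.1
  · rw [prod_univ, Measure.restrict_congr_set hset, Measure.snd,
      ← Measure.restrict_map measurable_snd measurableSet_Icc]
    exact congrArg (Measure.restrict · _) hγ.1.2
  · rw [← hγ.1.measure_fst measurableSet_Icc, ← hγ.1.measure_snd measurableSet_Icc]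
    exact measure_congr hset

end
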